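/- arXiv:2102.10156 — 4 statements merged into one kernel-verified Lean document; each statement's English description precedes it below -/
import Mathlib

section
/- Fix a finite set Ω with |Ω| ≥ 2, a horizon T ≥ 2, and Φ > 0, and for t ∈ {1,…,T−1} set ε_t := min{√(|Ω|/t)·(1 + √(Φ·log T)), 2}. For every probability distribution μ on Ω, if ω_0, ω_1, … are i.i.d. samples from μ and γ_t denotes the empirical distribution of the first t samples, then the probability that ‖γ_t − μ‖₁ > ε_t for some t ∈ {1,…,T−1} is at most T^{1 − 3Φ√|Ω|/56}. In particular, for Φ > 20 this probability is at most T^{−1/2}. (This is the persuasiveness bound of Theorem 1: the RAI algorithm with these parameters is β-persuasive with β bounded by this quantity.) -/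
/-- A probability distribution on a finite set `Ω`, viewed as a function `Ω → ℝ`. -/
def IsDist {Ω : Type*} [Fintype Ω] (μ : Ω → ℝ) : Prop :=
  (∀ ω, 0 ≤ μ ω) ∧ ∑ ω, μ ω = 1

/-- The ℓ1 distance between two functions on a finite set. -/
noncomputable def dist1 {Ω : Type*} [Fintype Ω] (μ ν : Ω → ℝ) : ℝ :=
  ∑ ω, |μ ω - ν ω|

/-- The probability of the event `E` when `T` states are drawn i.i.d. from `μ`. -/
noncomputable def prodProb {Ω : Type*} [Fintype Ω] {T : ℕ}
    (μ : Ω → ℝ) (E : Set (Fin T → Ω)) : ℝ :=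
  ∑ x : Fin T → Ω, Set.indicator E (fun y => ∏ t, μ (y t)) x

/-- The expectation of `f` when `T` states are drawn i.i.d. from `μ`. -/
noncomputable def prodExp {Ω : Type*} [Fintype Ω] {T : ℕ}
    (μ : Ω → ℝ) (f : (Fin T → Ω) → ℝ) : ℝ :=
  ∑ x : Fin T → Ω, (∏ t, μ (x t)) * f x

/-- The empirical distribution of the first `t` of the samples `x`. -/
noncomputable def emp {Ω : Type*} [Fintype Ω] [DecidableEq Ω] {T : ℕ}
    (x : Fin T → Ω) (t : ℕ) : Ω → ℝ :=
  fun ω => ((Finset.univ.filter fun τ : Fin T => τ.1 < t ∧ x τ = ω).card : ℝ) / t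

section FiniteProduct

variable {Ω : Type*} [Fintype Ω] {μ : Ω → ℝ}

theorem prodExp_succ {n : ℕ} (μ : Ω → ℝ) (f : (Fin (n + 1) → Ω) → ℝ) :
    prodExp μ f = prodExp μ (fun x => ∑ a, μ a * f (Fin.cons a x)) := by
  unfold prodExp
  rw [← (Fin.consEquiv (fun _ : Fin (n + 1) => Ω)).sum_comp, Fintype.sum_prod_type,
    Finset.sum_comm]
  refine Finset.sum_congr rfl fun x _ => ?_
  rw [Finset.mul_sum]
  refine Finset.sum_congr rfl fun a _ => ?_
  simp only [Fin.consEquiv_apply, Fin.prod_univ_succ, Fin.cons_zero, Fin.cons_succ]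
  rw [mul_comm (μ a), mul_assoc]
  rfl

theorem prodExp_mono {n : ℕ} (hμ : IsDist μ) {f g : (Fin n → Ω) → ℝ} (h : ∀ x, f x ≤ g x) :
    prodExp μ f ≤ prodExp μ g :=
  Finset.sum_le_sum fun x _ =>
    mul_le_mul_of_nonneg_left (h x) (Finset.prod_nonneg fun t _ => hμ.1 (x t))

theorem prodExp_add {n : ℕ} (f g : (Fin n → Ω) → ℝ) :
    prodExp μ (fun x => f x + g x) = prodExp μ f + prodExp μ g := by
  simp only [prodExp, mul_add, Finset.sum_add_distrib]

theorem prodExp_const_mul {n : ℕ} (c : ℝ) (f : (Fin n → Ω) → ℝ) :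
    prodExp μ (fun x => c * f x) = c * prodExp μ f := by
  simp only [prodExp, Finset.mul_sum]
  exact Finset.sum_congr rfl fun x _ => by ring

theorem prodExp_sum {n : ℕ} {ι : Type*} (s : Finset ι) (f : ι → (Fin n → Ω) → ℝ) :
    prodExp μ (fun x => ∑ i ∈ s, f i x) = ∑ i ∈ s, prodExp μ (f i) := by
  simp only [prodExp, Finset.mul_sum]
  exact Finset.sum_comm

theorem prodExp_const {n : ℕ} (hμ : IsDist μ) (c : ℝ) :
    prodExp μ (fun _ : Fin n → Ω => c) = c := by
  induction n with
  | zero => simp [prodExp]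
  | succ n ih => rw [prodExp_succ]; simpa [← Finset.sum_mul, hμ.2] using ih

theorem prodProb_eq_prodExp {n : ℕ} (μ : Ω → ℝ) (E : Set (Fin n → Ω)) :
    prodProb μ E = prodExp μ (E.indicator fun _ => 1) := by
  classical
  refine Finset.sum_congr rfl fun x _ => ?_
  by_cases h : x ∈ E <;> simp [h]

theorem prodExp_sq_le {n : ℕ} (hμ : IsDist μ) (f : (Fin n → Ω) → ℝ) :
    prodExp μ f ^ 2 ≤ prodExp μ (fun x => f x ^ 2) := by
  set m := prodExp μ f with hm
  have h : prodExp μ (fun _ : Fin n → Ω => (0 : ℝ)) ≤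
      prodExp μ (fun x => (f x ^ 2 + (-2 * m) * f x) + m ^ 2) :=
    prodExp_mono hμ fun x => by nlinarith [sq_nonneg (f x - m)]
  rw [prodExp_add, prodExp_add, prodExp_const_mul, prodExp_const hμ, prodExp_const hμ,
    ← hm] at h
  linarith

/-- A sum of independent centred variables is centred. -/
theorem prodExp_sum_eq_zero {n : ℕ} (hμ : IsDist μ) (g : Fin n → Ω → ℝ)
    (hg : ∀ i, ∑ a, μ a * g i a = 0) :
    prodExp μ (fun x => ∑ i, g i (x i)) = 0 := by
  induction n with
  | zero => simp [prodExp]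
  | succ n ih =>
    rw [prodExp_succ, ← ih (fun i => g i.succ) fun i => hg i.succ]
    congr 1
    funext x
    simp only [Fin.sum_univ_succ, Fin.cons_zero, Fin.cons_succ, mul_add,
      Finset.sum_add_distrib, hg, ← Finset.sum_mul, hμ.2]
    ring

/-- The variance of a sum of independent centred variables is the sum of the variances. -/
theorem prodExp_sum_sq {n : ℕ} (hμ : IsDist μ) (g : Fin n → Ω → ℝ)
    (hg : ∀ i, ∑ a, μ a * g i a = 0) :
    prodExp μ (fun x => (∑ i, g i (x i)) ^ 2) = ∑ i, ∑ a, μ a * g i a ^ 2 := by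
  induction n with
  | zero => simp [prodExp]
  | succ n ih =>
    rw [prodExp_succ, Fin.sum_univ_succ, ← ih (fun i => g i.succ) fun i => hg i.succ,
      ← prodExp_const (n := n) hμ (∑ a, μ a * g 0 a ^ 2), ← prodExp_add]
    congr 1
    funext x
    set S := ∑ i : Fin n, g i.succ (x i)
    have h : ∀ a, μ a * (∑ i, g i ((Fin.cons a x : Fin (n + 1) → Ω) i)) ^ 2
        = μ a * g 0 a ^ 2 + (2 * S) * (μ a * g 0 a) + μ a * S ^ 2 := fun a => by
      simp only [Fin.sum_univ_succ, Fin.cons_zero, Fin.cons_succ]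
      ring
    rw [Finset.sum_congr rfl fun a _ => h a, Finset.sum_add_distrib, Finset.sum_add_distrib,
      ← Finset.mul_sum, hg, ← Finset.sum_mul, hμ.2]
    ring

/-- A weak form of Hoeffding's lemma, obtained by symmetrization. -/
theorem sum_mul_exp_sub_mean_le (hμ : IsDist μ) (h : Ω → ℝ) (c : ℝ)
    (hc : ∀ a b, |h a - h b| ≤ c) :
    ∑ a, μ a * Real.exp (h a - ∑ b, μ b * h b) ≤ Real.exp (c ^ 2 / 2) := by
  have jensen : ∀ a, Real.exp (h a - ∑ b, μ b * h b) ≤ ∑ b, μ b * Real.exp (h a - h b) := by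
    intro a
    have key := convexOn_exp.map_sum_le (t := Finset.univ) (w := μ) (p := fun b => h a - h b)
      (fun b _ => hμ.1 b) hμ.2 (fun _ _ => Set.mem_univ _)
    simpa only [smul_eq_mul, mul_sub, Finset.sum_sub_distrib, ← Finset.sum_mul, hμ.2,
      one_mul] using key
  have swap : ∑ a, ∑ b, μ a * μ b * Real.exp (h a - h b)
      = ∑ a, ∑ b, μ a * μ b * Real.exp (-(h a - h b)) := by
    rw [Finset.sum_comm]
    refine Finset.sum_congr rfl fun a _ => Finset.sum_congr rfl fun b _ => ?_
    rw [neg_sub, mul_comm (μ b)]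
  have cosh_eq : ∑ a, ∑ b, μ a * μ b * Real.exp (h a - h b)
      = ∑ a, ∑ b, μ a * μ b * Real.cosh (h a - h b) := by
    simp only [Real.cosh_eq, mul_div_assoc', mul_add, ← Finset.sum_div, Finset.sum_add_distrib]
    rw [← swap]
    ring
  calc ∑ a, μ a * Real.exp (h a - ∑ b, μ b * h b)
      ≤ ∑ a, μ a * ∑ b, μ b * Real.exp (h a - h b) :=
        Finset.sum_le_sum fun a _ => mul_le_mul_of_nonneg_left (jensen a) (hμ.1 a)
    _ = ∑ a, ∑ b, μ a * μ b * Real.cosh (h a - h b) := by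
        rw [← cosh_eq]
        simp only [Finset.mul_sum, mul_assoc]
    _ ≤ ∑ a, ∑ b, μ a * μ b * Real.exp (c ^ 2 / 2) := by
        refine Finset.sum_le_sum fun a _ => Finset.sum_le_sum fun b _ =>
          mul_le_mul_of_nonneg_left ?_ (mul_nonneg (hμ.1 a) (hμ.1 b))
        refine (Real.cosh_le_exp_half_sq _).trans (Real.exp_le_exp.2 ?_)
        have := sq_le_sq' (neg_le_of_abs_le (hc a b)) (le_of_abs_le (hc a b))
        linarith
    _ = Real.exp (c ^ 2 / 2) := by
        simp only [← Finset.sum_mul, ← Finset.mul_sum, hμ.2, mul_one, one_mul]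

/-- The exponential moment bound behind McDiarmid's inequality. -/
theorem prodExp_exp_sub_mean_le {n : ℕ} (hμ : IsDist μ) (f : (Fin n → Ω) → ℝ) (c : Fin n → ℝ)
    (hc : ∀ i x y, (∀ j, j ≠ i → x j = y j) → |f x - f y| ≤ c i) :
    prodExp μ (fun x => Real.exp (f x - prodExp μ f)) ≤ Real.exp (∑ i, c i ^ 2 / 2) := by
  induction n with
  | zero => simp [prodExp, Subsingleton.elim _ (default : Fin 0 → Ω)]
  | succ n ih =>
    set g : (Fin n → Ω) → ℝ := fun x => ∑ a, μ a * f (Fin.cons a x) with hg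
    have hfg : prodExp μ f = prodExp μ g := prodExp_succ μ f
    have hgc : ∀ i x y, (∀ j, j ≠ i → x j = y j) → |g x - g y| ≤ c i.succ := by
      intro i x y hxy
      calc |g x - g y| = |∑ a, μ a * (f (Fin.cons a x) - f (Fin.cons a y))| := by
            simp only [hg, mul_sub, Finset.sum_sub_distrib]
        _ ≤ ∑ a, |μ a * (f (Fin.cons a x) - f (Fin.cons a y))| :=
            Finset.abs_sum_le_sum_abs _ _
        _ ≤ ∑ a, μ a * c i.succ := by
            refine Finset.sum_le_sum fun a _ => ?_
            rw [abs_mul, abs_of_nonneg (hμ.1 a)]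
            refine mul_le_mul_of_nonneg_left (hc _ _ _ fun j => ?_) (hμ.1 a)
            refine Fin.cases (fun _ => rfl) (fun k hk => ?_) j
            simpa using hxy k fun h => hk (h ▸ rfl)
        _ = c i.succ := by rw [← Finset.sum_mul, hμ.2, one_mul]
    rw [prodExp_succ, hfg, Fin.sum_univ_succ, Real.exp_add]
    calc prodExp μ (fun x => ∑ a, μ a * Real.exp (f (Fin.cons a x) - prodExp μ g))
        ≤ prodExp μ (fun x => Real.exp (c 0 ^ 2 / 2) * Real.exp (g x - prodExp μ g)) := by
          refine prodExp_mono hμ fun x => ?_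
          have h := sum_mul_exp_sub_mean_le hμ (fun a => f (Fin.cons a x)) (c 0) fun a b =>
            hc 0 _ _ fun j => Fin.cases (fun h => absurd rfl h) (fun _ _ => rfl) j
          refine le_trans (le_of_eq ?_) (mul_le_mul_of_nonneg_right h (Real.exp_pos _).le)
          rw [Finset.sum_mul]
          refine Finset.sum_congr rfl fun a _ => ?_
          rw [mul_assoc, ← Real.exp_add]
          simp only [hg]
          congr 2
          ring
      _ = Real.exp (c 0 ^ 2 / 2) * prodExp μ (fun x => Real.exp (g x - prodExp μ g)) :=
          prodExp_const_mul _ _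
      _ ≤ _ := mul_le_mul_of_nonneg_left (ih g (fun i => c i.succ) hgc) (Real.exp_pos _).le

end FiniteProduct

section Empirical

variable {Ω : Type*} [Fintype Ω] [DecidableEq Ω] {μ : Ω → ℝ}

theorem emp_eq_sum {T : ℕ} (x : Fin T → Ω) (t : ℕ) (ω : Ω) :
    emp x t ω = (∑ i : Fin T, if i.1 < t then (if x i = ω then (1 : ℝ) else 0) else 0) / t := by
  simp only [emp, Finset.card_filter, ite_and, Nat.cast_sum, Nat.cast_ite, Nat.cast_one,
    Nat.cast_zero]

theorem sum_ite_val_lt {T t : ℕ} (ht : t ≤ T) (c : ℝ) :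
    (∑ i : Fin T, if i.1 < t then c else 0) = t * c := by
  rw [← Finset.sum_filter, Finset.sum_const, nsmul_eq_mul, Fin.card_filter_val_lt,
    min_eq_right ht]

theorem emp_isDist {T t : ℕ} (x : Fin T → Ω) (h1 : 1 ≤ t) (ht : t ≤ T) :
    IsDist (emp x t) := by
  refine ⟨fun ω => by unfold emp; positivity, ?_⟩
  have h0 : (t : ℝ) ≠ 0 := by positivity
  simp only [emp_eq_sum, ← Finset.sum_div]
  rw [Finset.sum_comm, div_eq_one_iff_eq h0]
  have h : ∀ i : Fin T, (∑ ω, if i.1 < t then (if x i = ω then (1 : ℝ) else 0) else 0)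
      = if i.1 < t then 1 else 0 := fun i => by split_ifs <;> simp
  rw [Finset.sum_congr rfl fun i _ => h i, sum_ite_val_lt ht, mul_one]

theorem dist1_le_two {Ω : Type*} [Fintype Ω] {μ ν : Ω → ℝ} (hμ : IsDist μ) (hν : IsDist ν) :
    dist1 μ ν ≤ 2 := by
  calc dist1 μ ν ≤ ∑ ω, (μ ω + ν ω) := Finset.sum_le_sum fun ω _ => by
        rw [abs_le]
        constructor <;> linarith [hμ.1 ω, hν.1 ω]
    _ = 2 := by rw [Finset.sum_add_distrib, hμ.2, hν.2]; norm_num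

theorem abs_dist1_emp_sub_le {T : ℕ} (t : ℕ) (μ : Ω → ℝ) (i : Fin T) (x y : Fin T → Ω)
    (hxy : ∀ j, j ≠ i → x j = y j) :
    |dist1 (emp x t) μ - dist1 (emp y t) μ| ≤ if i.1 < t then 2 / (t : ℝ) else 0 := by
  have hdiff : ∀ ω, emp x t ω - emp y t ω = (if i.1 < t then
      ((if x i = ω then (1 : ℝ) else 0) - if y i = ω then 1 else 0) else 0) / t := by
    intro ω
    rw [emp_eq_sum, emp_eq_sum, ← sub_div, ← Finset.sum_sub_distrib,
      Finset.sum_eq_single i (fun j _ hj => by rw [hxy j hj, sub_self]) (by simp)]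
    split_ifs <;> simp
  calc |dist1 (emp x t) μ - dist1 (emp y t) μ|
      ≤ ∑ ω, |emp x t ω - emp y t ω| := by
        unfold dist1
        rw [← Finset.sum_sub_distrib]
        refine (Finset.abs_sum_le_sum_abs _ _).trans (Finset.sum_le_sum fun ω _ => ?_)
        have := abs_abs_sub_abs_le (emp x t ω - μ ω) (emp y t ω - μ ω)
        rwa [sub_sub_sub_cancel_right] at this
    _ ≤ _ := by
        simp only [hdiff]
        split_ifs with h
        · simp only [abs_div, Nat.abs_cast, ← Finset.sum_div]
          refine div_le_div_of_nonneg_right ?_ (Nat.cast_nonneg t)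
          calc ∑ ω, |(if x i = ω then (1 : ℝ) else 0) - if y i = ω then 1 else 0|
              ≤ ∑ ω, ((if x i = ω then (1 : ℝ) else 0) + if y i = ω then 1 else 0) :=
                Finset.sum_le_sum fun ω _ => by split_ifs <;> norm_num
            _ = 2 := by simp [Finset.sum_add_distrib]; norm_num
        · simp

/-- The mean square deviation of the empirical frequency of a single state. -/
theorem prodExp_emp_sub_sq_le {T t : ℕ} (hμ : IsDist μ) (h1 : 1 ≤ t) (ht : t ≤ T) (ω : Ω) :
    prodExp μ (fun x : Fin T → Ω => (emp x t ω - μ ω) ^ 2) ≤ μ ω / t := by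
  have h0 : (t : ℝ) ≠ 0 := by positivity
  set g : Fin T → Ω → ℝ := fun i a =>
    if i.1 < t then ((if a = ω then (1 : ℝ) else 0) - μ ω) else 0 with hg
  have hcentred : ∀ i, ∑ a, μ a * g i a = 0 := fun i => by
    simp only [hg]
    split_ifs <;> simp [mul_sub, Finset.sum_sub_distrib, ← Finset.sum_mul, hμ.2]
  have hemp : ∀ x : Fin T → Ω,
      (emp x t ω - μ ω) ^ 2 = ((t : ℝ) ^ 2)⁻¹ * (∑ i, g i (x i)) ^ 2 := fun x => by
    have : ∑ i, g i (x i) = t * (emp x t ω - μ ω) := by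
      rw [mul_sub, emp_eq_sum, mul_div_cancel₀ _ h0, ← sum_ite_val_lt ht (μ ω),
        ← Finset.sum_sub_distrib]
      refine Finset.sum_congr rfl fun i _ => ?_
      simp only [hg]
      split_ifs <;> simp
    rw [this]
    field_simp
  have hvar : ∀ i : Fin T, ∑ a, μ a * g i a ^ 2 ≤ if i.1 < t then μ ω else 0 := fun i => by
    simp only [hg]
    split_ifs
    · have : ∀ a, μ a * ((if a = ω then (1 : ℝ) else 0) - μ ω) ^ 2
          = (if a = ω then μ a else 0) * (1 - 2 * μ ω) + μ a * μ ω ^ 2 := fun a => by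
        split_ifs <;> ring
      rw [Finset.sum_congr rfl fun a _ => this a, Finset.sum_add_distrib, ← Finset.sum_mul,
        ← Finset.sum_mul, hμ.2, Finset.sum_ite_eq' Finset.univ ω, if_pos (Finset.mem_univ ω)]
      nlinarith [sq_nonneg (μ ω)]
    · simp
  simp only [hemp]
  rw [prodExp_const_mul, prodExp_sum_sq hμ g hcentred]
  calc ((t : ℝ) ^ 2)⁻¹ * ∑ i, ∑ a, μ a * g i a ^ 2 ≤ ((t : ℝ) ^ 2)⁻¹ * (t * μ ω) := by
        rw [← sum_ite_val_lt ht (μ ω)]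
        exact mul_le_mul_of_nonneg_left (Finset.sum_le_sum fun i _ => hvar i) (by positivity)
    _ = μ ω / t := by field_simp

theorem prodExp_dist1_emp_le {T t : ℕ} (hμ : IsDist μ) (h1 : 1 ≤ t) (ht : t ≤ T) :
    prodExp μ (fun x : Fin T → Ω => dist1 (emp x t) μ) ≤
      Real.sqrt ((Fintype.card Ω : ℝ) / t) := by
  refine Real.le_sqrt_of_sq_le ?_
  calc prodExp μ (fun x : Fin T → Ω => dist1 (emp x t) μ) ^ 2
      ≤ prodExp μ (fun x : Fin T → Ω => dist1 (emp x t) μ ^ 2) := prodExp_sq_le hμ _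
    _ ≤ prodExp μ (fun x : Fin T → Ω =>
          (Fintype.card Ω : ℝ) * ∑ ω, (emp x t ω - μ ω) ^ 2) := by
        refine prodExp_mono hμ fun x => ?_
        simpa only [sq_abs, dist1, Finset.card_univ] using sq_sum_le_card_mul_sum_sq (s := Finset.univ)
          (f := fun ω => |emp x t ω - μ ω|)
    _ ≤ (Fintype.card Ω : ℝ) * ∑ ω, μ ω / t := by
        rw [prodExp_const_mul, prodExp_sum]
        exact mul_le_mul_of_nonneg_left
          (Finset.sum_le_sum fun ω _ => prodExp_emp_sub_sq_le hμ h1 ht ω) (Nat.cast_nonneg _)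
    _ = (Fintype.card Ω : ℝ) / t := by rw [← Finset.sum_div, hμ.2, mul_one_div]

/-- Concentration of the empirical distribution in the ℓ1 distance. -/
theorem prodProb_dist1_emp_gt_le {T t : ℕ} (hμ : IsDist μ) (h1 : 1 ≤ t) (ht : t ≤ T)
    {s : ℝ} (hs : 0 ≤ s) :
    prodProb μ {x : Fin T → Ω | Real.sqrt ((Fintype.card Ω : ℝ) / t) + s < dist1 (emp x t) μ}
      ≤ Real.exp (-(t * s ^ 2 / 8)) := by
  have h0 : (t : ℝ) ≠ 0 := by positivity
  set l : ℝ := t * s / 4 with hl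
  have hl0 : 0 ≤ l := by positivity
  set F : (Fin T → Ω) → ℝ := fun x => l * dist1 (emp x t) μ with hF
  have hmean : prodExp μ F ≤ l * Real.sqrt ((Fintype.card Ω : ℝ) / t) := by
    rw [hF, prodExp_const_mul]
    exact mul_le_mul_of_nonneg_left (prodExp_dist1_emp_le hμ h1 ht) hl0
  have hmgf := prodExp_exp_sub_mean_le hμ F
    (fun i => l * if i.1 < t then 2 / (t : ℝ) else 0) fun i x y hxy => by
      rw [hF, ← mul_sub, abs_mul, abs_of_nonneg hl0]
      exact mul_le_mul_of_nonneg_left (abs_dist1_emp_sub_le t μ i x y hxy) hl0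
  have hsum : ∑ i : Fin T, (l * if i.1 < t then 2 / (t : ℝ) else 0) ^ 2 / 2
      = t * s ^ 2 / 8 := by
    have : ∀ i : Fin T, (l * if i.1 < t then 2 / (t : ℝ) else 0) ^ 2 / 2
        = if i.1 < t then (l * (2 / (t : ℝ))) ^ 2 / 2 else 0 := fun i => by
      split_ifs <;> simp
    rw [Finset.sum_congr rfl fun i _ => this i, sum_ite_val_lt ht, hl]
    field_simp
    ring
  rw [hsum] at hmgf
  rw [prodProb_eq_prodExp]
  calc prodExp μ (Set.indicator {x : Fin T → Ω |
          Real.sqrt ((Fintype.card Ω : ℝ) / t) + s < dist1 (emp x t) μ} fun _ => 1)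
      ≤ prodExp μ (fun x => Real.exp (-(l * s)) * Real.exp (F x - prodExp μ F)) := by
        refine prodExp_mono hμ fun x => Set.indicator_apply_le' (fun hx => ?_) fun _ => by
          positivity
        rw [← Real.exp_add]
        refine Real.one_le_exp ?_
        have := mul_le_mul_of_nonneg_left (le_of_lt hx) hl0
        simp only [hF] at hmean ⊢
        linarith
    _ ≤ Real.exp (-(l * s)) * Real.exp (t * s ^ 2 / 8) := by
        rw [prodExp_const_mul]
        exact mul_le_mul_of_nonneg_left hmgf (Real.exp_pos _).le
    _ = Real.exp (-(t * s ^ 2 / 8)) := by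
        rw [← Real.exp_add, hl]
        congr 1
        ring

end Empirical

/-- The union bound over `t ∈ {1, …, T − 1}`. -/
theorem prodProb_exists_le_sum {Ω : Type*} [Fintype Ω] {μ : Ω → ℝ} (hμ : IsDist μ) {T : ℕ}
    (E : Set (Fin T → Ω)) (F : ℕ → Set (Fin T → Ω))
    (hE : ∀ x ∈ E, ∃ t : ℕ, 1 ≤ t ∧ t < T ∧ x ∈ F t) :
    prodProb μ E ≤ ∑ t ∈ Finset.Ico 1 T, prodProb μ (F t) := by
  simp only [prodProb_eq_prodExp]
  rw [← prodExp_sum]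
  refine prodExp_mono hμ fun x => ?_
  have hnn : ∀ t, 0 ≤ (F t).indicator (fun _ => (1 : ℝ)) x := fun t =>
    Set.indicator_nonneg (fun _ _ => zero_le_one) x
  by_cases hx : x ∈ E
  · obtain ⟨t, h1, hT, hxt⟩ := hE x hx
    rw [Set.indicator_of_mem hx]
    refine (Set.indicator_of_mem hxt fun _ => (1 : ℝ)).ge.trans ?_
    exact Finset.single_le_sum (f := fun t => (F t).indicator (fun _ => (1 : ℝ)) x)
      (fun t _ => hnn t) (Finset.mem_Ico.2 ⟨h1, hT⟩)
  · rw [Set.indicator_of_notMem hx]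
    exact Finset.sum_nonneg fun t _ => hnn t

/-- Persuasiveness bound of Theorem 1: with `ε_t = min{√(|Ω|/t)(1 + √(Φ log T)), 2}`,
the probability that the empirical distribution `γ_t` ever leaves the ℓ1-ball of radius
`ε_t` around the true prior `μ` (for some `t ∈ {1, …, T−1}`) is at most
`T^{1 − 3Φ√|Ω|/56}`, and at most `T^{−1/2}` once `Φ > 20`. -/
theorem stmt0 {Ω : Type*} [Fintype Ω] [DecidableEq Ω]
    (hΩ : 2 ≤ Fintype.card Ω) (T : ℕ) (hT : 2 ≤ T) (Φ : ℝ) (hΦ : 0 < Φ)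
    (μ : Ω → ℝ) (hμ : IsDist μ)
    (ε : ℕ → ℝ)
    (hε : ∀ t : ℕ, 1 ≤ t →
      ε t = min (Real.sqrt ((Fintype.card Ω : ℝ) / t) * (1 + Real.sqrt (Φ * Real.log T))) 2) :
    prodProb μ {x : Fin T → Ω | ∃ t : ℕ, 1 ≤ t ∧ t < T ∧ ε t < dist1 (emp x t) μ}
      ≤ (T : ℝ) ^ (1 - 3 * Φ * Real.sqrt (Fintype.card Ω) / 56)
    ∧ (20 < Φ →
        prodProb μ {x : Fin T → Ω | ∃ t : ℕ, 1 ≤ t ∧ t < T ∧ ε t < dist1 (emp x t) μ}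
          ≤ (T : ℝ) ^ (-(1 / 2) : ℝ)) := by
  have hT1 : (1 : ℝ) ≤ T := by exact_mod_cast (by omega : 1 ≤ T)
  have hT0 : (0 : ℝ) < T := by linarith
  have hu : 0 ≤ Φ * Real.log T := mul_nonneg hΦ.le (Real.log_nonneg hT1)
  have hcard : (2 : ℝ) ≤ Fintype.card Ω := by exact_mod_cast hΩ
  set N : ℝ := (Fintype.card Ω : ℝ) with hN
  have hsqrt : Real.sqrt N ^ 2 = N := Real.sq_sqrt (by linarith)
  have hsqrt' : (7 / 5 : ℝ) ≤ Real.sqrt N := Real.le_sqrt_of_sq_le (by norm_num; linarith)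
  have main : prodProb μ {x : Fin T → Ω | ∃ t : ℕ, 1 ≤ t ∧ t < T ∧ ε t < dist1 (emp x t) μ}
      ≤ (T : ℝ) ^ (1 - 3 * Φ * Real.sqrt N / 56) := by
    calc prodProb μ {x : Fin T → Ω | ∃ t : ℕ, 1 ≤ t ∧ t < T ∧ ε t < dist1 (emp x t) μ}
        ≤ ∑ t ∈ Finset.Ico 1 T, prodProb μ {x : Fin T → Ω |
            Real.sqrt (N / t) + Real.sqrt (N / t) * Real.sqrt (Φ * Real.log T)
              < dist1 (emp x t) μ} := by
          refine prodProb_exists_le_sum hμ _ _ ?_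
          rintro x ⟨t, h1, hT, hx⟩
          refine ⟨t, h1, hT, ?_⟩
          rw [hε t h1] at hx
          rcases min_lt_iff.1 hx with h | h
          · rwa [mul_add, mul_one] at h
          · exact absurd h (dist1_le_two (emp_isDist x h1 hT.le) hμ).not_gt
      _ ≤ ∑ t ∈ Finset.Ico 1 T, Real.exp (-(N * (Φ * Real.log T) / 8)) := by
          refine Finset.sum_le_sum fun t ht => ?_
          obtain ⟨h1, hT⟩ := Finset.mem_Ico.1 ht
          have h0 : (t : ℝ) ≠ 0 := by positivity
          refine (prodProb_dist1_emp_gt_le hμ h1 hT.le (by positivity)).trans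
            (Real.exp_le_exp.2 (le_of_eq ?_))
          rw [mul_pow, Real.sq_sqrt hu, Real.sq_sqrt (by positivity)]
          field_simp
      _ ≤ T * Real.exp (-(N * (Φ * Real.log T) / 8)) := by
          rw [Finset.sum_const, Nat.card_Ico, nsmul_eq_mul]
          refine mul_le_mul_of_nonneg_right ?_ (Real.exp_pos _).le
          exact_mod_cast Nat.sub_le T 1
      _ ≤ (T : ℝ) ^ (1 - 3 * Φ * Real.sqrt N / 56) := by
          rw [Real.rpow_def_of_pos hT0, mul_sub, mul_one, sub_eq_add_neg, Real.exp_add,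
            Real.exp_log hT0]
          refine mul_le_mul_of_nonneg_left (Real.exp_le_exp.2 (neg_le_neg ?_)) hT0.le
          have hroot : 3 * Real.sqrt N / 56 ≤ N / 8 := by nlinarith
          nlinarith [mul_le_mul_of_nonneg_right hroot hu]
  refine ⟨main, fun hΦ' => main.trans (Real.rpow_le_rpow_of_exponent_le hT1 ?_)⟩
  nlinarith
end

section
/- Proposition 1 (cost of robust persuasion, upper bound). Assume the regularity condition with constant D > 0, and let p0 > 0. For any μ ∈ Δ(Ω) with min_ω μ(ω) ≥ p0 and any ε ≥ 0, GAP(μ, B₁(μ,ε)) ≤ (4/(p0²·D))·ε, where GAP(μ, B) := sup_{σ ∈ Pers(μ)} V(μ,σ) − sup_{σ ∈ Pers(B)} V(μ,σ). -/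
/-- A signaling mechanism: `σ ω` is a distribution over actions for each state `ω`. -/
def IsMech {Ω A : Type*} [Fintype A] (σ : Ω → A → ℝ) : Prop :=
  ∀ ω, IsDist (σ ω)

/-- The obedience (persuasiveness) constraints for the prior `μ`. -/
def Pers {Ω A : Type*} [Fintype Ω] (u : Ω → A → ℝ) (μ : Ω → ℝ) (σ : Ω → A → ℝ) : Prop :=
  ∀ a a' : A, 0 ≤ ∑ ω, μ ω * σ ω a * (u ω a - u ω a')

/-- Persuasiveness simultaneously for all priors in a set `B`. -/
def PersOn {Ω A : Type*} [Fintype Ω] (u : Ω → A → ℝ) (B : Set (Ω → ℝ)) (σ : Ω → A → ℝ) : Prop :=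
  ∀ μ ∈ B, Pers u μ σ

/-- The sender's expected utility `V(μ, σ)`. -/
noncomputable def Val {Ω A : Type*} [Fintype Ω] [Fintype A]
    (v : Ω → A → ℝ) (μ : Ω → ℝ) (σ : Ω → A → ℝ) : ℝ :=
  ∑ ω, ∑ a, μ ω * σ ω a * v ω a

/-- The closed ℓ1-ball of radius `ε` around `μ`, inside the simplex `Δ(Ω)`. -/
def ball1 {Ω : Type*} [Fintype Ω] (μ : Ω → ℝ) (ε : ℝ) : Set (Ω → ℝ) :=
  {ν | IsDist ν ∧ dist1 ν μ ≤ ε}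

/-- The sender's optimal value `OPT(μ)` over mechanisms persuasive for `μ`. -/
noncomputable def OPT {Ω A : Type*} [Fintype Ω] [Fintype A]
    (u v : Ω → A → ℝ) (μ : Ω → ℝ) : ℝ :=
  sSup (Val v μ '' {σ | IsMech σ ∧ Pers u μ σ})

/-- The sender's optimal value at `μ` over mechanisms persuasive for all priors in `B`. -/
noncomputable def OPTRobust {Ω A : Type*} [Fintype Ω] [Fintype A]
    (u v : Ω → A → ℝ) (μ : Ω → ℝ) (B : Set (Ω → ℝ)) : ℝ :=
  sSup (Val v μ '' {σ | IsMech σ ∧ PersOn u B σ})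

/-- The cost of robust persuasion `GAP(μ, B)`. -/
noncomputable def GAP {Ω A : Type*} [Fintype Ω] [Fintype A]
    (u v : Ω → A → ℝ) (μ : Ω → ℝ) (B : Set (Ω → ℝ)) : ℝ :=
  OPT u v μ - OPTRobust u v μ B

/-- `P_a`: the set of beliefs for which action `a` is optimal for the receiver. -/
def Popt {Ω A : Type*} [Fintype Ω] [Fintype A] (u : Ω → A → ℝ) (a : A) : Set (Ω → ℝ) :=
  {μ | IsDist μ ∧ ∀ a' : A, ∑ ω, μ ω * u ω a' ≤ ∑ ω, μ ω * u ω a}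

theorem IsDist.le_one {Ω : Type*} [Fintype Ω] {μ : Ω → ℝ} (hμ : IsDist μ) (ω : Ω) : μ ω ≤ 1 :=
  hμ.2 ▸ Finset.single_le_sum (fun i _ => hμ.1 i) (Finset.mem_univ ω)

theorem Val_nonneg {Ω A : Type*} [Fintype Ω] [Fintype A] {v : Ω → A → ℝ}
    (hv : ∀ ω a, v ω a ∈ Set.Icc (0 : ℝ) 1) {μ : Ω → ℝ} (hμ : IsDist μ)
    {σ : Ω → A → ℝ} (hσ : IsMech σ) : 0 ≤ Val v μ σ :=
  Finset.sum_nonneg fun ω _ => Finset.sum_nonneg fun a _ =>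
    mul_nonneg (mul_nonneg (hμ.1 ω) ((hσ ω).1 a)) (hv ω a).1

theorem Val_le_one {Ω A : Type*} [Fintype Ω] [Fintype A] {v : Ω → A → ℝ}
    (hv : ∀ ω a, v ω a ∈ Set.Icc (0 : ℝ) 1) {μ : Ω → ℝ} (hμ : IsDist μ)
    {σ : Ω → A → ℝ} (hσ : IsMech σ) : Val v μ σ ≤ 1 := by
  calc Val v μ σ ≤ ∑ ω, ∑ a, μ ω * σ ω a :=
        Finset.sum_le_sum fun ω _ => Finset.sum_le_sum fun a _ =>
          mul_le_of_le_one_right (mul_nonneg (hμ.1 ω) ((hσ ω).1 a)) (hv ω a).2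
    _ = 1 := by simp_rw [← Finset.mul_sum, (hσ _).2, mul_one, hμ.2]

/-- Moving mass `t ≤ D / 2` from `η` to the state `j` stays in the ball of radius `D`. -/
theorem mix_single_mem_ball1 {Ω : Type*} [Fintype Ω] [DecidableEq Ω] {η : Ω → ℝ}
    (hη : IsDist η) {t D : ℝ} (ht0 : 0 ≤ t) (ht1 : t ≤ 1) (htD : 2 * t ≤ D) (j : Ω) :
    (fun ω => (1 - t) * η ω + t * (if ω = j then 1 else 0)) ∈ ball1 η D := by
  refine ⟨⟨fun ω => ?_, ?_⟩, ?_⟩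
  · have := hη.1 ω
    have : (0 : ℝ) ≤ if ω = j then 1 else 0 := by split_ifs <;> norm_num
    have : 0 ≤ 1 - t := by linarith
    positivity
  · rw [Finset.sum_add_distrib, ← Finset.mul_sum, ← Finset.mul_sum, hη.2]
    simp
  · refine le_trans ?_ htD
    calc dist1 (fun ω => (1 - t) * η ω + t * (if ω = j then 1 else 0)) η
        ≤ ∑ ω, t * ((if ω = j then 1 else 0) + η ω) := by
          refine Finset.sum_le_sum fun ω _ => ?_
          have h0 := hη.1 ω
          beta_reduce
          split_ifs <;> rw [abs_le] <;> constructor <;> nlinarith [hη.le_one ω]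
      _ = 2 * t := by
          rw [← Finset.mul_sum, Finset.sum_add_distrib, hη.2]
          simp only [Finset.sum_ite_eq', Finset.mem_univ, if_true]
          ring

/-- If a ball around `η` lies in `P_a`, then the utility advantage of `a` over `a'` in any single
state is bounded below in terms of its expectation under `η`. -/
theorem advantage_lower_bound {Ω A : Type*} [Fintype Ω] [Fintype A] {u : Ω → A → ℝ} {a : A}
    {η : Ω → ℝ} {D t : ℝ} (hη : IsDist η) (hball : ball1 η D ⊆ Popt u a)
    (ht0 : 0 ≤ t) (ht1 : t ≤ 1) (htD : 2 * t ≤ D) (a' : A) (j : Ω) :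
    0 ≤ (1 - t) * ∑ ω, η ω * (u ω a - u ω a') + t * (u j a - u j a') := by
  classical
  have h := (hball (mix_single_mem_ball1 hη ht0 ht1 htD j)).2 a'
  rw [← sub_nonneg, ← Finset.sum_sub_distrib] at h
  refine h.trans_eq ?_
  have key : ∀ ω, ((1 - t) * η ω + t * (if ω = j then 1 else 0)) * u ω a -
      ((1 - t) * η ω + t * (if ω = j then 1 else 0)) * u ω a' =
      (1 - t) * (η ω * (u ω a - u ω a')) +
        t * (if ω = j then u ω a - u ω a' else 0) := by
    intro ω; split_ifs <;> ring
  simp_rw [key]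
  rw [Finset.sum_add_distrib, ← Finset.mul_sum, ← Finset.mul_sum]
  simp

/-- Multiplicative perturbation by factors in `[1 - r, 1 + r]` of a nonnegative weight `x`. -/
theorem sum_perturbed_ge {Ω : Type*} [Fintype Ω] {x q g : Ω → ℝ} {r L : ℝ}
    (hx : ∀ ω, 0 ≤ x ω) (hr : 0 ≤ r) (hL : 0 ≤ L) (hg : ∀ ω, -L ≤ g ω)
    (hq : ∀ ω, 1 - r ≤ q ω) (hq' : ∀ ω, q ω ≤ 1 + r) :
    (1 - r) * ∑ ω, x ω * g ω - 2 * r * L * ∑ ω, x ω ≤ ∑ ω, q ω * x ω * g ω := by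
  rw [Finset.mul_sum, Finset.mul_sum, ← Finset.sum_sub_distrib]
  refine Finset.sum_le_sum fun ω _ => ?_
  have key : (1 - r) * g ω - 2 * r * L ≤ q ω * g ω := by
    rcases le_total 0 (g ω) with h | h
    · nlinarith [mul_le_mul_of_nonneg_right (hq ω) h, mul_nonneg hr hL]
    · nlinarith [mul_le_mul_of_nonpos_right (hq' ω) h, mul_le_mul_of_nonneg_left (hg ω) hr]
  nlinarith [mul_le_mul_of_nonneg_left key (hx ω)]

/-- The weights `α • y + δ w • η`, where `y` has mass `w` and nonnegative advantage, keep a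
nonnegative advantage under multiplicative perturbations of size `r` when `δ D = 4 r`. -/
theorem perturbed_advantage_nonneg {Ω A : Type*} [Fintype Ω] [Fintype A] {u : Ω → A → ℝ} {a : A}
    {η : Ω → ℝ} {D : ℝ} (hD : 0 < D) (hη : IsDist η) (hηa : η ∈ Popt u a)
    (hball : ball1 η D ⊆ Popt u a) (a' : A) {y q : Ω → ℝ} (hy : ∀ ω, 0 ≤ y ω)
    (hyg : 0 ≤ ∑ ω, y ω * (u ω a - u ω a')) {α δ r : ℝ} (hα : 0 ≤ α) (hδ : 0 ≤ δ)
    (hαδ : α + δ ≤ 1) (hr : 0 ≤ r) (hδr : δ * D = 4 * r)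
    (hq0 : ∀ ω, 0 ≤ q ω) (hq : ∀ ω, 1 - r ≤ q ω) (hq' : ∀ ω, q ω ≤ 1 + r) :
    0 ≤ ∑ ω, q ω * (α * y ω + δ * (∑ ω', y ω') * η ω) * (u ω a - u ω a') := by
  have hw : 0 ≤ ∑ ω', y ω' := Finset.sum_nonneg fun ω _ => hy ω
  set w := ∑ ω', y ω' with hwdef
  have hx : ∀ ω, 0 ≤ α * y ω + δ * w * η ω := fun ω => by
    have := hy ω; have := hη.1 ω; positivity
  rcases le_or_gt 2 D with hD2 | hD2
  · refine Finset.sum_nonneg fun ω _ => mul_nonneg (mul_nonneg (hq0 ω) (hx ω)) ?_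
    have := advantage_lower_bound (t := 1) hη hball (by norm_num) le_rfl (by linarith) a' ω
    linarith
  have hM : 0 ≤ ∑ ω, η ω * (u ω a - u ω a') := by
    simp_rw [mul_sub, Finset.sum_sub_distrib]
    linarith [hηa.2 a']
  have hlow := advantage_lower_bound (t := D / 2) hη hball (by linarith) (by linarith)
    (by linarith) a'
  set M := ∑ ω, η ω * (u ω a - u ω a') with hMdef
  have hK : 0 ≤ 2 / D - 1 := by rw [sub_nonneg, one_le_div hD]; exact hD2.le
  have hg : ∀ ω, -((2 / D - 1) * M) ≤ u ω a - u ω a' := fun ω => by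
    have h := mul_nonneg (div_nonneg zero_le_two hD.le) (hlow ω)
    have e : 2 / D * ((1 - D / 2) * M + D / 2 * (u ω a - u ω a')) =
      (2 / D - 1) * M + (u ω a - u ω a') := by field_simp
    linarith
  refine le_trans ?_ (sum_perturbed_ge hx hr (mul_nonneg hK hM) hg hq hq')
  have e1 : ∑ ω, (α * y ω + δ * w * η ω) * (u ω a - u ω a') =
      α * ∑ ω, y ω * (u ω a - u ω a') + δ * w * M := by
    rw [hMdef, Finset.mul_sum _ _ α, Finset.mul_sum _ _ (δ * w), ← Finset.sum_add_distrib]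
    exact Finset.sum_congr rfl fun ω _ => by ring
  have e2 : ∑ ω, (α * y ω + δ * w * η ω) = (α + δ) * w := by
    rw [Finset.sum_add_distrib, ← Finset.mul_sum, ← Finset.mul_sum, hη.2, ← hwdef]
    ring
  rw [e1, e2]
  have hδ1 : δ ≤ 1 := by linarith
  have hr1 : 0 ≤ 1 - r := by nlinarith
  have hrK : 2 * r * (2 / D - 1) = δ - 2 * r := by
    have : r = δ * D / 4 := by linarith
    rw [this]; field_simp; ring
  have hrK0 : 0 ≤ δ - 2 * r := hrK ▸ by positivity
  have hcoef : 0 ≤ (1 - r) * δ - (δ - 2 * r) * (α + δ) := by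
    nlinarith [mul_le_mul_of_nonneg_left hαδ hrK0, mul_le_mul_of_nonneg_left hδ1 hr]
  have h1 := mul_nonneg hr1 (mul_nonneg hα hyg)
  have h2 := mul_nonneg hcoef (mul_nonneg hw hM)
  have e3 : 2 * r * ((2 / D - 1) * M) = (δ - 2 * r) * M := by rw [← hrK]; ring
  rw [e3]
  linarith

/-- Any mechanism persuasive at `μ` can be made robustly persuasive on the ball of radius `ε`
by modifying it on a set of probability at most `δ / p0`. -/
theorem exists_robust_mech {Ω A : Type*} [Fintype Ω] [Fintype A] [Nonempty Ω] [Nonempty A]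
    {u : Ω → A → ℝ} {D : ℝ} (hD : 0 < D)
    (hreg : ∀ a : A, ∃ η : Ω → ℝ, η ∈ Popt u a ∧ ball1 η D ⊆ Popt u a)
    {p0 : ℝ} (hp0 : 0 < p0) {μ : Ω → ℝ} (hμ : IsDist μ) (hμp : ∀ ω, p0 ≤ μ ω)
    {ε δ : ℝ} (hε : 0 ≤ ε) (hδ : δ * D = 4 * (ε / p0)) (hδp : δ / p0 ≤ 1)
    {σ : Ω → A → ℝ} (hσ : IsMech σ) (hσP : Pers u μ σ) :
    ∃ σ' : Ω → A → ℝ, IsMech σ' ∧ PersOn u (ball1 μ ε) σ' ∧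
      ∀ ω a, (1 - δ / p0) * σ ω a ≤ σ' ω a := by
  classical
  choose η hη hball using hreg
  have hbest : ∀ ω, ∃ b : A, ∀ a, u ω a ≤ u ω b := fun ω => Finite.exists_max (u ω)
  choose b hb using hbest
  have hr : 0 ≤ ε / p0 := by positivity
  have hδ0 : 0 ≤ δ := nonneg_of_mul_nonneg_left (hδ ▸ by positivity) hD
  have hμ0 : ∀ ω, 0 < μ ω := fun ω => hp0.trans_le (hμp ω)
  have hp1 : p0 ≤ 1 := (hμp (Classical.arbitrary Ω)).trans (hμ.le_one _)
  have hα : 0 ≤ 1 - δ / p0 := by linarith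
  have hδδ : δ ≤ δ / p0 := by rw [le_div_iff₀ hp0]; exact mul_le_of_le_one_right hδ0 hp1
  set w : A → ℝ := fun a => ∑ ω, μ ω * σ ω a with hw
  have hw0 : ∀ a, 0 ≤ w a := fun a =>
    Finset.sum_nonneg fun ω _ => mul_nonneg (hμ.1 ω) ((hσ ω).1 a)
  have hw1 : ∑ a, w a = 1 := by
    rw [hw, Finset.sum_comm]
    simp_rw [← Finset.mul_sum, (hσ _).2, mul_one, hμ.2]
  set s : Ω → A → ℝ := fun ω a => (1 - δ / p0) * σ ω a + δ * w a * η a ω / μ ω with hs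
  have hs_ge : ∀ ω a, (1 - δ / p0) * σ ω a ≤ s ω a := fun ω a => by
    have := hw0 a; have := (hη a).1.1 ω; have := hμ0 ω
    exact le_add_of_nonneg_right (by positivity)
  have hs0 : ∀ ω a, 0 ≤ s ω a := fun ω a => (mul_nonneg hα ((hσ ω).1 a)).trans (hs_ge ω a)
  have hs1 : ∀ ω, ∑ a, s ω a ≤ 1 := fun ω => by
    rw [hs, Finset.sum_add_distrib, ← Finset.mul_sum, (hσ ω).2]
    have : ∑ a, δ * w a * η a ω / μ ω ≤ ∑ a, δ / p0 * w a := by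
      refine Finset.sum_le_sum fun a _ => ?_
      have h1 : δ * w a * η a ω ≤ δ * w a :=
        mul_le_of_le_one_right (mul_nonneg hδ0 (hw0 a)) ((hη a).1.le_one ω)
      calc δ * w a * η a ω / μ ω ≤ δ * w a / p0 :=
            div_le_div₀ (mul_nonneg hδ0 (hw0 a)) h1 hp0 (hμp ω)
        _ = δ / p0 * w a := by ring
    rw [← Finset.mul_sum, hw1] at this
    linarith
  have hrest : ∀ ω a, 0 ≤ if a = b ω then 1 - ∑ a', s ω a' else 0 := fun ω a => by
    split_ifs
    · linarith [hs1 ω]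
    · exact le_rfl
  refine ⟨fun ω a => s ω a + if a = b ω then 1 - ∑ a', s ω a' else 0,
    fun ω => ⟨fun a => add_nonneg (hs0 ω a) (hrest ω a), ?_⟩, ?_,
    fun ω a => (hs_ge ω a).trans (le_add_of_nonneg_right (hrest ω a))⟩
  · rw [Finset.sum_add_distrib]
    simp
  · rintro ν ⟨hν, hνμ⟩ a a'
    have hdev : ∀ ω, |ν ω - μ ω| ≤ ε / p0 * μ ω := fun ω => by
      refine ((Finset.single_le_sum (f := fun i => |ν i - μ i|) (fun i _ => abs_nonneg _)
        (Finset.mem_univ ω)).trans hνμ).trans ?_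
      calc ε = ε / p0 * p0 := by field_simp
        _ ≤ ε / p0 * μ ω := mul_le_mul_of_nonneg_left (hμp ω) hr
    have hmain := perturbed_advantage_nonneg (q := fun ω => ν ω / μ ω)
      (y := fun ω => μ ω * σ ω a) hD (hη a).1 (hη a) (hball a) a'
      (fun ω => mul_nonneg (hμ.1 ω) ((hσ ω).1 a)) (hσP a a') hα hδ0 (by linarith) hr hδ
      (fun ω => div_nonneg (hν.1 ω) (hμ.1 ω))
      (fun ω => by rw [le_div_iff₀ (hμ0 ω)]; linarith [(abs_le.1 (hdev ω)).1])
      (fun ω => by rw [div_le_iff₀ (hμ0 ω)]; linarith [(abs_le.1 (hdev ω)).2])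
    refine hmain.trans (Finset.sum_le_sum fun ω _ => ?_)
    have e : ν ω / μ ω * ((1 - δ / p0) * (μ ω * σ ω a) +
        δ * (∑ ω', μ ω' * σ ω' a) * η a ω) = ν ω * s ω a := by
      have := (hμ0 ω).ne'
      simp only [hs, hw]
      field_simp
    rw [e, mul_add _ (s ω a), add_mul (ν ω * s ω a)]
    refine le_add_of_nonneg_right ?_
    by_cases h : a = b ω
    · exact mul_nonneg (mul_nonneg (hν.1 ω) (hrest ω a))
        (sub_nonneg.2 ((hb ω a').trans_eq (by rw [h])))
    · simp [h]

/-- Proposition 1 (cost of robust persuasion, upper bound): under the regularity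
condition with constant `D`, for any fully supported prior `μ` (with `min_ω μ(ω) ≥ p0`)
and any `ε ≥ 0`, `GAP(μ, B₁(μ, ε)) ≤ (4 / (p0² D)) · ε`. -/
theorem stmt2 {Ω A : Type*} [Fintype Ω] [Fintype A]
    (hΩ : 2 ≤ Fintype.card Ω) (hA : 2 ≤ Fintype.card A)
    (u : Ω → A → ℝ) (v : Ω → A → ℝ) (hv : ∀ ω a, v ω a ∈ Set.Icc (0 : ℝ) 1)
    (D : ℝ) (hD : 0 < D)
    (hreg : ∀ a : A, ∃ η : Ω → ℝ, η ∈ Popt u a ∧ ball1 η D ⊆ Popt u a)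
    (p0 : ℝ) (hp0 : 0 < p0)
    (μ : Ω → ℝ) (hμ : IsDist μ) (hμp : ∀ ω, p0 ≤ μ ω)
    (ε : ℝ) (hε : 0 ≤ ε) :
    GAP u v μ (ball1 μ ε) ≤ (4 / (p0 ^ 2 * D)) * ε := by
  have : Nonempty Ω := Fintype.card_pos_iff.1 (by omega)
  have : Nonempty A := Fintype.card_pos_iff.1 (by omega)
  have hbound : 0 ≤ 4 / (p0 ^ 2 * D) * ε := by positivity
  have hrobust : 0 ≤ OPTRobust u v μ (ball1 μ ε) := by
    refine Real.sSup_nonneg ?_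
    rintro _ ⟨σ, hσ, rfl⟩
    exact Val_nonneg hv hμ hσ.1
  rw [GAP, sub_le_iff_le_add]
  refine Real.sSup_le ?_ (add_nonneg hbound hrobust)
  rintro _ ⟨σ, ⟨hσ, hσP⟩, rfl⟩
  have hval1 := Val_le_one hv hμ hσ
  rcases le_or_gt 1 (4 / (p0 ^ 2 * D) * ε) with h1 | h1
  · linarith
  have hδ : 4 * ε / (p0 * D) / p0 = 4 / (p0 ^ 2 * D) * ε := by field_simp
  obtain ⟨σ', hσ', hpers, hge⟩ := exists_robust_mech (δ := 4 * ε / (p0 * D)) hD hreg hp0 hμ hμp hε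
    (by field_simp) (hδ ▸ h1.le) hσ hσP
  rw [hδ] at hge
  have hle : Val v μ σ' ≤ OPTRobust u v μ (ball1 μ ε) := by
    refine le_csSup ⟨1, ?_⟩ ⟨σ', ⟨hσ', hpers⟩, rfl⟩
    rintro _ ⟨τ, hτ, rfl⟩
    exact Val_le_one hv hμ hτ.1
  have hscale : (1 - 4 / (p0 ^ 2 * D) * ε) * Val v μ σ ≤ Val v μ σ' := by
    simp only [Val, Finset.mul_sum]
    refine Finset.sum_le_sum fun ω _ => Finset.sum_le_sum fun a _ => ?_
    have h := mul_le_mul_of_nonneg_right (mul_le_mul_of_nonneg_left (hge ω a) (hμ.1 ω)) (hv ω a).1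
    linarith
  nlinarith [mul_le_mul_of_nonneg_left hval1 hbound]
end

section
/- Proposition 2, part 1. For the explicit instance I₀ with parameters p0 ∈ (0, 1/3) and D > 0 satisfying D·p0 < 1/64, the sender's optimal value at the prior μ* = (p0, (1−p0)/2, (1−p0)/2) equals 1: OPT(μ*) = 1. In particular, the signaling mechanism σ* defined by σ*(ω0,a1)=σ*(ω0,a2)=1/2, σ*(ω1,a1)=σ*(ω2,a2)=1/2 + D/(2(1−p0)), σ*(ω1,a2)=σ*(ω2,a1)=1/2 − D/(2(1−p0)), and σ*(ω,a)=0 otherwise, is persuasive for μ* and achieves V(μ*,σ*) = 1. -/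
/-- The receiver's utility in the explicit instance `I₀` (states `Fin 3`, actions `Fin 5`),
with parameters `p0` and `D`. -/
noncomputable def u0 (p0 D : ℝ) : Fin 3 → Fin 5 → ℝ :=
  ![![0, 2 * D ^ 2, 2 * D ^ 2, -2 * D * (1 - p0 - 2 * D), -2 * D * (1 - p0 - 2 * D)],
    ![0, (1 - 2 * D) * (1 - D) - p0, (D + 1) * (2 * D - 1) + p0,
      2 * (1 - p0 - 2 * D) * (1 - D), -2 * (1 - p0 - 2 * D) * (D + 1)],
    ![0, (D + 1) * (2 * D - 1) + p0, (1 - 2 * D) * (1 - D) - p0,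
      -2 * (1 - p0 - 2 * D) * (D + 1), 2 * (1 - p0 - 2 * D) * (1 - D)]]

/-- The sender's utility in the instance `I₀`: `1` on actions `a₁, a₂` and `0` otherwise. -/
def v0 : Fin 3 → Fin 5 → ℝ :=
  fun _ a => if a = 1 ∨ a = 2 then 1 else 0

/-- The prior `μ* = (p0, (1−p0)/2, (1−p0)/2)` of the instance `I₀`. -/
noncomputable def μstar3 (p0 : ℝ) : Fin 3 → ℝ :=
  ![p0, (1 - p0) / 2, (1 - p0) / 2]

/-- The optimal signaling mechanism `σ*` for the prior `μ*` in the instance `I₀`. -/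
noncomputable def σstar (p0 D : ℝ) : Fin 3 → Fin 5 → ℝ :=
  ![![0, 1 / 2, 1 / 2, 0, 0],
    ![0, 1 / 2 + D / (2 * (1 - p0)), 1 / 2 - D / (2 * (1 - p0)), 0, 0],
    ![0, 1 / 2 - D / (2 * (1 - p0)), 1 / 2 + D / (2 * (1 - p0)), 0, 0]]

theorem isMech_σstar {p0 D : ℝ} (hp0 : p0 < 1) (hD : 0 ≤ D) (hinst : 0 ≤ 1 - p0 - 2 * D) :
    IsMech (σstar p0 D) := by
  have hq : 0 < 1 - p0 := by linarith
  have ht : 0 ≤ D / (2 * (1 - p0)) := by positivity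
  have ht' : D / (2 * (1 - p0)) ≤ 1 / 2 := by
    rw [div_le_iff₀ (by linarith)]; linarith
  intro ω
  refine ⟨fun a => ?_, ?_⟩
  · fin_cases ω <;> fin_cases a <;> simp [σstar] <;> linarith
  · fin_cases ω <;> simp [σstar, Fin.sum_univ_five] <;> ring

theorem pers_σstar {p0 D : ℝ} (hp0 : p0 < 1) (hD : 0 ≤ D)
    (hinst : 0 ≤ 1 - p0 - 2 * D) :
    Pers (u0 p0 D) (μstar3 p0) (σstar p0 D) := by
  have hq : 1 - p0 ≠ 0 := by linarith
  have hhigh : (1 - p0) / 2 * (1 / 2 + D / (2 * (1 - p0))) = (1 - p0 + D) / 4 := by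
    field_simp; ring
  have hlow : (1 - p0) / 2 * (1 / 2 - D / (2 * (1 - p0))) = (1 - p0 - D) / 4 := by
    field_simp; ring
  have hDq : 0 ≤ D * (1 - p0 - 2 * D) := by positivity
  intro a a'
  fin_cases a <;> fin_cases a' <;>
    simp only [Fin.sum_univ_three, μstar3, σstar, u0, Fin.zero_eta, Fin.mk_one, Fin.reduceFinMk,
      Matrix.cons_val, mul_zero, zero_mul, add_zero, le_refl, hhigh, hlow] <;>
    ring_nf at hDq ⊢ <;> linarith

theorem val_v0_le_one {p0 : ℝ} (hp0 : 0 ≤ p0) (hp0' : p0 ≤ 1) {σ : Fin 3 → Fin 5 → ℝ}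
    (hσ : IsMech σ) : Val v0 (μstar3 p0) σ ≤ 1 := by
  have hμ : ∀ ω, 0 ≤ μstar3 p0 ω := by
    intro ω
    fin_cases ω <;> simp [μstar3] <;> linarith
  calc Val v0 (μstar3 p0) σ ≤ ∑ ω, ∑ a, μstar3 p0 ω * σ ω a := by
        refine Finset.sum_le_sum fun ω _ => Finset.sum_le_sum fun a _ => ?_
        refine mul_le_of_le_one_right (mul_nonneg (hμ ω) ((hσ ω).1 a)) ?_
        unfold v0; split_ifs <;> norm_num
    _ = ∑ ω, μstar3 p0 ω := by simp [← Finset.mul_sum, (hσ _).2]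
    _ = 1 := by simp only [Fin.sum_univ_three, μstar3, Matrix.cons_val]; ring

theorem val_σstar (p0 D : ℝ) : Val v0 (μstar3 p0) (σstar p0 D) = 1 := by
  simp [Val, Fin.sum_univ_three, Fin.sum_univ_five, μstar3, σstar, v0]
  ring

/-- Proposition 2, part 1: in the instance `I₀` (with `p0 ∈ (0, 1/3)`, `D > 0`,
`1 − p0 − 2D > 0`, `D·p0 < 1/64`), the mechanism `σ*` is persuasive for `μ*` and achieves
sender value `1`; consequently `OPT(μ*) = 1`. -/
theorem stmt4 (p0 D : ℝ) (hp0 : 0 < p0) (hp03 : p0 < 1 / 3) (hD : 0 < D)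
    (hinst : 0 < 1 - p0 - 2 * D) (hDp0 : D * p0 < 1 / 64) :
    IsMech (σstar p0 D)
    ∧ Pers (u0 p0 D) (μstar3 p0) (σstar p0 D)
    ∧ Val v0 (μstar3 p0) (σstar p0 D) = 1
    ∧ OPT (u0 p0 D) v0 (μstar3 p0) = 1 := by
  have hmech : IsMech (σstar p0 D) := isMech_σstar (by linarith) hD.le hinst.le
  have hpers : Pers (u0 p0 D) (μstar3 p0) (σstar p0 D) :=
    pers_σstar (by linarith) hD.le hinst.le
  refine ⟨hmech, hpers, val_σstar p0 D, ?_⟩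
  refine IsGreatest.csSup_eq ⟨⟨σstar p0 D, ⟨hmech, hpers⟩, val_σstar p0 D⟩, ?_⟩
  rintro _ ⟨σ, ⟨hσ, -⟩, rfl⟩
  exact val_v0_le_one hp0.le (by linarith) hσ
end

section
/- Lipschitz-type bound for the optimal sender value: for any μ1, μ2 ∈ Δ(Ω), OPT(μ1) − OPT(μ2) ≤ GAP(μ1, B₁(μ1, ‖μ1 − μ2‖₁)) + (1/2)·‖μ1 − μ2‖₁, where GAP(μ, B) := sup_{σ ∈ Pers(μ)} V(μ,σ) − sup_{σ ∈ Pers(B)} V(μ,σ). -/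
/-- A mechanism averages `v ω ·` with weights `σ ω`, so the average stays in `[0, 1]`. -/
theorem IsMech.sum_mul_mem_Icc {Ω A : Type*} [Fintype A] {σ v : Ω → A → ℝ} (hσ : IsMech σ)
    (hv : ∀ ω a, v ω a ∈ Set.Icc (0 : ℝ) 1) (ω : Ω) :
    ∑ a, σ ω a * v ω a ∈ Set.Icc (0 : ℝ) 1 := by
  refine ⟨Finset.sum_nonneg fun a _ => mul_nonneg ((hσ ω).1 a) (hv ω a).1, ?_⟩
  rw [← (hσ ω).2]
  exact Finset.sum_le_sum fun a _ => mul_le_of_le_one_right ((hσ ω).1 a) (hv ω a).2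

theorem Val_eq_sum_mul {Ω A : Type*} [Fintype Ω] [Fintype A] (v : Ω → A → ℝ) (μ : Ω → ℝ)
    (σ : Ω → A → ℝ) : Val v μ σ = ∑ ω, μ ω * ∑ a, σ ω a * v ω a := by
  simp only [Val, Finset.mul_sum, mul_assoc]

theorem Val_mem_Icc {Ω A : Type*} [Fintype Ω] [Fintype A] {v σ : Ω → A → ℝ} {μ : Ω → ℝ}
    (hμ : IsDist μ) (hσ : IsMech σ) (hv : ∀ ω a, v ω a ∈ Set.Icc (0 : ℝ) 1) :
    Val v μ σ ∈ Set.Icc (0 : ℝ) 1 := by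
  rw [Val_eq_sum_mul]
  refine ⟨Finset.sum_nonneg fun ω _ => mul_nonneg (hμ.1 ω) (hσ.sum_mul_mem_Icc hv ω).1, ?_⟩
  rw [← hμ.2]
  exact Finset.sum_le_sum fun ω _ =>
    mul_le_of_le_one_right (hμ.1 ω) (hσ.sum_mul_mem_Icc hv ω).2

/-- For a fixed mechanism, the sender's utility is `1/2`-Lipschitz in the prior. -/
theorem Val_le_Val_add_dist1 {Ω A : Type*} [Fintype Ω] [Fintype A] {v σ : Ω → A → ℝ}
    {μ ν : Ω → ℝ} (hμ : IsDist μ) (hν : IsDist ν) (hσ : IsMech σ)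
    (hv : ∀ ω a, v ω a ∈ Set.Icc (0 : ℝ) 1) :
    Val v μ σ ≤ Val v ν σ + (1 / 2) * dist1 μ ν := by
  have key : ∑ ω, (μ ω - ν ω) * (∑ a, σ ω a * v ω a - 1 / 2) ≤ (1 / 2) * dist1 μ ν := by
    rw [dist1, Finset.mul_sum]
    refine Finset.sum_le_sum fun ω _ => ?_
    obtain ⟨h0, h1⟩ := hσ.sum_mul_mem_Icc hv ω
    have habs : |∑ a, σ ω a * v ω a - 1 / 2| ≤ 1 / 2 := abs_le.2 ⟨by linarith, by linarith⟩
    calc (μ ω - ν ω) * (∑ a, σ ω a * v ω a - 1 / 2)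
        ≤ |μ ω - ν ω| * |∑ a, σ ω a * v ω a - 1 / 2| := (le_abs_self _).trans (abs_mul _ _).le
      _ ≤ |μ ω - ν ω| * (1 / 2) := by gcongr
      _ = 1 / 2 * |μ ω - ν ω| := mul_comm _ _
  have expand : ∑ ω, (μ ω - ν ω) * (∑ a, σ ω a * v ω a - 1 / 2) = Val v μ σ - Val v ν σ := by
    simp only [Val_eq_sum_mul, mul_sub, sub_mul, Finset.sum_sub_distrib, ← Finset.sum_mul,
      hμ.2, hν.2]
    ring
  linarith

/-- Lipschitz-type bound for the optimal sender value:
`OPT(μ1) − OPT(μ2) ≤ GAP(μ1, B₁(μ1, ‖μ1 − μ2‖₁)) + (1/2)·‖μ1 − μ2‖₁`. -/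
theorem stmt7 {Ω A : Type*} [Fintype Ω] [Fintype A]
    (hΩ : 2 ≤ Fintype.card Ω) (hA : 2 ≤ Fintype.card A)
    (u : Ω → A → ℝ) (v : Ω → A → ℝ) (hv : ∀ ω a, v ω a ∈ Set.Icc (0 : ℝ) 1)
    (μ1 μ2 : Ω → ℝ) (hμ1 : IsDist μ1) (hμ2 : IsDist μ2) :
    OPT u v μ1 - OPT u v μ2
      ≤ GAP u v μ1 (ball1 μ1 (dist1 μ1 μ2)) + (1 / 2) * dist1 μ1 μ2 := by
  have hnn : 0 ≤ OPT u v μ2 := by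
    refine Real.sSup_nonneg ?_
    rintro _ ⟨σ, hσ, rfl⟩
    exact (Val_mem_Icc hμ2 hσ.1 hv).1
  have hbdd : BddAbove (Val v μ2 '' {σ | IsMech σ ∧ Pers u μ2 σ}) := by
    refine ⟨1, ?_⟩
    rintro _ ⟨σ, hσ, rfl⟩
    exact (Val_mem_Icc hμ2 hσ.1 hv).2
  have hmem : μ2 ∈ ball1 μ1 (dist1 μ1 μ2) :=
    ⟨hμ2, (Finset.sum_congr rfl fun _ _ => abs_sub_comm _ _).le⟩
  have hd : 0 ≤ dist1 μ1 μ2 := Finset.sum_nonneg fun _ _ => abs_nonneg _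
  have hle : OPTRobust u v μ1 (ball1 μ1 (dist1 μ1 μ2))
      ≤ OPT u v μ2 + (1 / 2) * dist1 μ1 μ2 := by
    refine Real.sSup_le ?_ (by positivity)
    rintro _ ⟨σ, hσ, rfl⟩
    have hopt : Val v μ2 σ ≤ OPT u v μ2 := le_csSup hbdd ⟨σ, ⟨hσ.1, hσ.2 μ2 hmem⟩, rfl⟩
    linarith [Val_le_Val_add_dist1 hμ1 hμ2 hσ.1 hv]
  unfold GAP
  linarith
end
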